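/- Statistical indistinguishability of a concentrated measurement distribution from fair coin flips: let p⁺ be a [0,1]-valued random variable (the probability of outcome +1 when measuring a Pauli observable on a random QRP instance) with E[p⁺] = 1/2 and Var[p⁺] ≤ β for some β > 0. Then with probability at least 1 − √β over the draw of p⁺, one has |p⁺ − 1/2| ≤ β^{1/4}; and on this event, for any number of samples N, any decision rule attempting to distinguish N i.i.d. samples of the binary distribution (p⁺, 1 − p⁺) from N i.i.d. samples of the uniform distribution (1/2, 1/2), given that each alternative occurs with probability 1/2, succeeds with probability at most 1/2 + N·β^{1/4}/2. In particular, if β ∈ O(1/bⁿ) for some b > 1 and N ∈ O(poly(n)), the success probability is at most 1/2 + ε with ε exponentially small in n, so polynomially many measurement shots cannot distinguish the QRP output from an input-independent random variable. -/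

import Mathlib

open MeasureTheory

namespace QRP

/-- Variance of a real random variable with respect to a measure. -/
noncomputable def var {Ω : Type*} [MeasurableSpace Ω] (μ : Measure Ω) (f : Ω → ℝ) : ℝ :=
  ∫ x, (f x - ∫ y, f y ∂μ) ^ 2 ∂μ

/-- Probability that a Bernoulli-type sample on `{0,1} ≅ Bool` equals `b`, when the chance of
`true` is `p` (so the distribution is `(p, 1-p)`). -/
def bern (p : ℝ) (b : Bool) : ℝ := if b then p else 1 - p

/-- Success probability of a decision rule `g` distinguishing `N` i.i.d. samples of the binary
distribution `(p, 1-p)` from `N` i.i.d. samples of the uniform distribution `(1/2, 1/2)`,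
each alternative occurring with probability `1/2` (`true` = guess biased, `false` = uniform). -/
noncomputable def distinguishSuccess (N : ℕ) (p : ℝ) (g : (Fin N → Bool) → Bool) : ℝ :=
  (1 / 2) * (∑ x ∈ Finset.univ.filter (fun x : Fin N → Bool => g x = true),
      ∏ i, bern p (x i))
    + (1 / 2) * (∑ x ∈ Finset.univ.filter (fun x : Fin N → Bool => g x = false),
      ∏ i, bern (1 / 2) (x i))

lemma bern_nonneg {p : ℝ} (h0 : 0 ≤ p) (h1 : p ≤ 1) (b : Bool) : 0 ≤ bern p b := by
  cases b <;> simp [bern, h0, h1]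

lemma sum_fin_succ_bool {N : ℕ} (F : (Fin (N + 1) → Bool) → ℝ) :
    ∑ x, F x =
      ∑ y : Fin N → Bool, F (Fin.cons true y) + ∑ y : Fin N → Bool, F (Fin.cons false y) := by
  rw [← (Fin.consEquiv fun _ : Fin (N + 1) => Bool).sum_comp, Fintype.sum_prod_type]
  simp [Fin.consEquiv]

lemma sum_prod_bern (N : ℕ) (p : ℝ) : ∑ x : Fin N → Bool, ∏ i, bern p (x i) = 1 := by
  rw [← Fintype.prod_sum fun (_ : Fin N) b => bern p b]
  simp [bern]

/-- The expectations of a `[0,1]`-valued test under `N` samples of `(p, 1-p)` and of `(q, 1-q)`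
differ by at most `N * |p - q|`. -/
lemma sum_mul_prod_bern_sub_le {p q : ℝ} (hp0 : 0 ≤ p) (hp1 : p ≤ 1) (hq0 : 0 ≤ q) (hq1 : q ≤ 1)
    (N : ℕ) (f : (Fin N → Bool) → ℝ) (hf0 : ∀ x, 0 ≤ f x) (hf1 : ∀ x, f x ≤ 1) :
    ∑ x, f x * ∏ i, bern p (x i) - ∑ x, f x * ∏ i, bern q (x i) ≤ N * |p - q| := by
  induction N with
  | zero => simp
  | succ N ih =>
    have hT := ih (fun y => f (Fin.cons true y)) (fun _ => hf0 _) (fun _ => hf1 _)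
    have hF := ih (fun y => f (Fin.cons false y)) (fun _ => hf0 _) (fun _ => hf1 _)
    have hbound (b : Bool) :
        0 ≤ ∑ y : Fin N → Bool, f (Fin.cons b y) * ∏ i, bern q (y i) ∧
          ∑ y : Fin N → Bool, f (Fin.cons b y) * ∏ i, bern q (y i) ≤ 1 := by
      have hprod (y : Fin N → Bool) : 0 ≤ ∏ i, bern q (y i) :=
        Finset.prod_nonneg fun i _ => bern_nonneg hq0 hq1 _
      refine ⟨Finset.sum_nonneg fun y _ => mul_nonneg (hf0 _) (hprod y), ?_⟩
      rw [← sum_prod_bern N q]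
      exact Finset.sum_le_sum fun y _ => mul_le_of_le_one_left (hprod y) (hf1 _)
    have hsplit (r : ℝ) : ∑ x : Fin (N + 1) → Bool, f x * ∏ i, bern r (x i) =
        r * ∑ y : Fin N → Bool, f (Fin.cons true y) * ∏ i, bern r (y i) +
          (1 - r) * ∑ y : Fin N → Bool, f (Fin.cons false y) * ∏ i, bern r (y i) := by
      rw [sum_fin_succ_bool, Finset.mul_sum, Finset.mul_sum]
      congr 1 <;> refine Finset.sum_congr rfl fun y _ => ?_ <;>
        simp [Fin.prod_univ_succ, bern] <;> ring
    rw [hsplit p, hsplit q]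
    obtain ⟨hT0, hT1⟩ := hbound true
    obtain ⟨hF0, hF1⟩ := hbound false
    have hT' := mul_le_mul_of_nonneg_left hT hp0
    have hF' := mul_le_mul_of_nonneg_left hF (sub_nonneg.mpr hp1)
    set a := ∑ y : Fin N → Bool, f (Fin.cons true y) * ∏ i, bern q (y i)
    set b := ∑ y : Fin N → Bool, f (Fin.cons false y) * ∏ i, bern q (y i)
    have hab : (p - q) * (a - b) ≤ |p - q| := by
      refine (le_abs_self _).trans ?_
      rw [abs_mul]
      exact mul_le_of_le_one_right (abs_nonneg _) (abs_le.mpr ⟨by linarith, by linarith⟩)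
    push_cast
    linarith

lemma distinguishSuccess_le {p : ℝ} (h0 : 0 ≤ p) (h1 : p ≤ 1) (N : ℕ)
    (g : (Fin N → Bool) → Bool) :
    distinguishSuccess N p g ≤ 1 / 2 + N * |p - 1 / 2| / 2 := by
  have h := sum_mul_prod_bern_sub_le h0 h1 (q := 1 / 2) (by norm_num) (by norm_num) N
    (fun x => if g x = true then 1 else 0) (fun x => by split_ifs <;> norm_num)
    (fun x => by split_ifs <;> norm_num)
  have hsum := Finset.sum_filter_add_sum_filter_not Finset.univ (fun x => g x = true)
    fun x : Fin N → Bool => ∏ i, bern (1 / 2) (x i)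
  rw [sum_prod_bern] at hsum
  simp only [ite_mul, one_mul, zero_mul, ← Finset.sum_filter] at h
  simp only [Bool.not_eq_true] at hsum
  unfold distinguishSuccess
  linarith

/-- Chebyshev's inequality with deviation threshold `β ^ (1 / 4)`. -/
lemma one_sub_sqrt_le_measure_abs_sub_le {Ω : Type*} [MeasurableSpace Ω] (μ : Measure Ω)
    [IsProbabilityMeasure μ] {X : Ω → ℝ} (hX : Measurable X) {c β : ℝ} (hβ : 0 < β)
    (hint : Integrable (fun ω => (X ω - c) ^ 2) μ) (hvar : ∫ ω, (X ω - c) ^ 2 ∂μ ≤ β) :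
    1 - √β ≤ μ.real {ω | |X ω - c| ≤ β ^ ((1 : ℝ) / 4)} := by
  have hmeas : MeasurableSet {ω | |X ω - c| ≤ β ^ ((1 : ℝ) / 4)} :=
    measurableSet_le (by fun_prop) measurable_const
  have hmarkov := mul_meas_ge_le_integral_of_nonneg
    (Filter.Eventually.of_forall fun ω => sq_nonneg (X ω - c)) hint √β
  have hroot : (β ^ ((1 : ℝ) / 4)) ^ 2 = √β := by
    rw [← Real.rpow_natCast, ← Real.rpow_mul hβ.le, Real.sqrt_eq_rpow]
    norm_num
  have hsub : {ω | |X ω - c| ≤ β ^ ((1 : ℝ) / 4)}ᶜ ⊆ {ω | √β ≤ (X ω - c) ^ 2} := by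
    intro ω hω
    simp only [Set.mem_compl_iff, Set.mem_ofPred_eq, not_le] at hω ⊢
    rw [← hroot, ← sq_abs (X ω - c)]
    gcongr
  have hmono := measureReal_mono (μ := μ) hsub
  rw [probReal_compl_eq_one_sub hmeas] at hmono
  have hle : μ.real {ω | √β ≤ (X ω - c) ^ 2} ≤ √β := by
    refine le_of_mul_le_mul_left ?_ (Real.sqrt_pos.mpr hβ)
    rw [Real.mul_self_sqrt hβ.le]
    exact hmarkov.trans hvar
  linarith

/-- Supplemental Theorem 5, statistical indistinguishability. If a random
outcome probability `p⁺ ∈ [0,1]` satisfies `E[p⁺] = 1/2` and `Var[p⁺] ≤ β`, then with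
probability at least `1 - √β` one has `|p⁺ - 1/2| ≤ β^{1/4}`, and on this event any decision
rule using `N` samples distinguishes `(p⁺, 1-p⁺)` from the fair coin with success probability
at most `1/2 + N·β^{1/4}/2`. -/
theorem concentrated_outputs_indistinguishable_from_fair_coin
    {Ω : Type*} [MeasurableSpace Ω] (μ : Measure Ω) [IsProbabilityMeasure μ]
    (pplus : Ω → ℝ) (hmeas : Measurable pplus)
    (hval : ∀ ω, 0 ≤ pplus ω ∧ pplus ω ≤ 1)
    (β : ℝ) (hβ : 0 < β)
    (hmean : (∫ ω, pplus ω ∂μ) = 1 / 2)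
    (hvar : var μ pplus ≤ β) :
    1 - Real.sqrt β ≤ (μ {ω | |pplus ω - 1 / 2| ≤ β ^ ((1 : ℝ) / 4)}).toReal ∧
    ∀ ω, |pplus ω - 1 / 2| ≤ β ^ ((1 : ℝ) / 4) →
      ∀ (N : ℕ) (g : (Fin N → Bool) → Bool),
        distinguishSuccess N (pplus ω) g ≤ 1 / 2 + (N : ℝ) * β ^ ((1 : ℝ) / 4) / 2 := by
  refine ⟨one_sub_sqrt_le_measure_abs_sub_le μ hmeas hβ ?_ ?_, fun ω hω N g => ?_⟩
  · refine Integrable.of_bound (by fun_prop) 1 (Filter.Eventually.of_forall fun ω => ?_)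
    obtain ⟨h0, h1⟩ := hval ω
    rw [Real.norm_eq_abs, abs_of_nonneg (sq_nonneg _)]
    nlinarith
  · simpa only [var, hmean] using hvar
  · refine (distinguishSuccess_le (hval ω).1 (hval ω).2 N g).trans ?_
    gcongr

end QRP
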